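/- Let R be a commutative ring with many units. There is a surjective homomorphism from R^×/⟨−1, r² : r ∈ R^×⟩ onto B'(R)/B(R) which, for every a with a, 1−a ∈ R^×, sends the class of a to the class of ⟨a⟩ := [a] + [a^{-1}]. In particular, B'(R)/B(R) is a 2-torsion group generated by the classes of the elements ⟨a⟩ with a, 1−a ∈ R^×. Moreover, if every unit of R is a square, then B(R) = B'(R). -/

import Mathlib

/-- `R^× ⊗_ℤ R^×`: the tensor square of the (additively written) abelian group of
units of `R`. -/
abbrev TT (R : Type) [CommRing R] : Type :=
  TensorProduct ℤ (Additive Rˣ) (Additive Rˣ)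

/-- The elementary tensor `a ⊗ b` for units `a b : Rˣ`. -/
noncomputable def tmulU (R : Type) [CommRing R] (a b : Rˣ) : TT R :=
  TensorProduct.tmul ℤ (Additive.ofMul a) (Additive.ofMul b)

/-- The subgroup of `R^× ⊗ R^×` generated by the elements `a ⊗ b + b ⊗ a`. -/
noncomputable def sigmaSub (R : Type) [CommRing R] : AddSubgroup (TT R) :=
  AddSubgroup.closure {x | ∃ a b : Rˣ, x = tmulU R a b + tmulU R b a}

/-- `(R^× ⊗ R^×)_σ`. -/
abbrev Tsigma (R : Type) [CommRing R] : Type := TT R ⧸ sigmaSub R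

/-- Canonical projection onto `(R^× ⊗ R^×)_σ`. -/
noncomputable def clsS (R : Type) [CommRing R] : TT R →+ Tsigma R :=
  QuotientAddGroup.mk' _

/-- The subgroup of `R^× ⊗ R^×` generated by the elements `a ⊗ (-a)`. -/
noncomputable def sbarSub (R : Type) [CommRing R] : AddSubgroup (TT R) :=
  AddSubgroup.closure {x | ∃ a : Rˣ, x = tmulU R a (-a)}

/-- `(R^× ⊗ R^×)_σ̄`. -/
abbrev Tsigmabar (R : Type) [CommRing R] : Type := TT R ⧸ sbarSub R

/-- Canonical projection onto `(R^× ⊗ R^×)_σ̄`. -/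
noncomputable def clsSb (R : Type) [CommRing R] : TT R →+ Tsigmabar R :=
  QuotientAddGroup.mk' _

/-- The subgroup of `R^× ⊗ R^×` generated by the elements `a ⊗ (1-a)`
with `a`, `1-a` units. -/
noncomputable def k2Sub (R : Type) [CommRing R] : AddSubgroup (TT R) :=
  AddSubgroup.closure {x | ∃ a b : Rˣ, (b : R) = 1 - (a : R) ∧ x = tmulU R a b}

/-- The Milnor K-group `K_2^M(R)`. -/
abbrev K2M (R : Type) [CommRing R] : Type := TT R ⧸ k2Sub R

/-- Canonical projection onto `K_2^M(R)`; `clsK R (tmulU R a b)` is the symbol `{a, b}`. -/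
noncomputable def clsK (R : Type) [CommRing R] : TT R →+ K2M R :=
  QuotientAddGroup.mk' _
/-- A commutative ring has *many units* if for every `n ≥ 2` and every finite family of
surjective linear forms `f i : R^n → R` there is a vector `v` with all `f i v` units. -/
def ManyUnits (R : Type) [CommRing R] : Prop :=
  ∀ n : ℕ, 2 ≤ n → ∀ (k : ℕ) (f : Fin k → ((Fin n → R) →ₗ[R] R)),
    (∀ i, Function.Surjective (f i)) → ∃ v : Fin n → R, ∀ i, IsUnit (f i v)
/-- The index set for the generators `[a]` of the pre-Bloch group: elements `a` of `R`
with `a` and `1 - a` units. -/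
abbrev Wt (R : Type) [CommRing R] : Type := {a : R // IsUnit a ∧ IsUnit (1 - a)}

/-- The subgroup of relations of the pre-Bloch group: it is generated by the elements
`[a] - [b] + [b/a] - [(1-a⁻¹)/(1-b⁻¹)] + [(1-a)/(1-b)]` for `a, 1-a, b, 1-b, a-b` units. -/
noncomputable def pbRel (R : Type) [CommRing R] : AddSubgroup (Wt R →₀ ℤ) :=
  AddSubgroup.closure
    {x | ∃ a b c d e : Wt R, IsUnit ((a : R) - (b : R)) ∧
      (c : R) = (b : R) * Ring.inverse (a : R) ∧
      (d : R) = (1 - Ring.inverse (a : R)) * Ring.inverse (1 - Ring.inverse (b : R)) ∧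
      (e : R) = (1 - (a : R)) * Ring.inverse (1 - (b : R)) ∧
      x = Finsupp.single a 1 - Finsupp.single b 1 + Finsupp.single c 1
          - Finsupp.single d 1 + Finsupp.single e 1}

/-- The pre-Bloch group `𝔭(R)`. -/
abbrev pBloch (R : Type) [CommRing R] : Type := (Wt R →₀ ℤ) ⧸ pbRel R

/-- The generator `[a]` of the pre-Bloch group. -/
noncomputable def pcl (R : Type) [CommRing R] (a : Wt R) : pBloch R :=
  QuotientAddGroup.mk (Finsupp.single a 1)

section UnitTensors

variable {R : Type} [CommRing R]

theorem tmulU_mul_left (a b c : Rˣ) : tmulU R (a * b) c = tmulU R a c + tmulU R b c := by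
  simp only [tmulU, ofMul_mul, TensorProduct.add_tmul]

theorem tmulU_mul_right (a b c : Rˣ) : tmulU R a (b * c) = tmulU R a b + tmulU R a c := by
  simp only [tmulU, ofMul_mul, TensorProduct.tmul_add]

theorem tmulU_one_right (a : Rˣ) : tmulU R a 1 = 0 := by
  simp only [tmulU, ofMul_one, TensorProduct.tmul_zero]

theorem tmulU_inv_left (a b : Rˣ) : tmulU R a⁻¹ b = -tmulU R a b := by
  simp only [tmulU, ofMul_inv, TensorProduct.neg_tmul]

theorem clsS_tmulU_add_swap (a b : Rˣ) :
    clsS R (tmulU R a b) + clsS R (tmulU R b a) = 0 := by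
  rw [← map_add]
  exact (QuotientAddGroup.eq_zero_iff _).2 (AddSubgroup.subset_closure ⟨a, b, rfl⟩)

theorem tmulU_mul_neg_mul (a b : Rˣ) :
    tmulU R (a * b) (-(a * b)) =
      tmulU R a (-a) + tmulU R b (-b) + (tmulU R a b + tmulU R b a) := by
  rw [tmulU_mul_left, ← neg_mul, tmulU_mul_right, neg_mul_comm, tmulU_mul_right]
  abel

theorem sigmaSub_le_sbarSub : sigmaSub R ≤ sbarSub R := by
  refine (AddSubgroup.closure_le _).2 ?_
  rintro _ ⟨a, b, rfl⟩
  have gen : ∀ c : Rˣ, tmulU R c (-c) ∈ sbarSub R :=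
    fun c => AddSubgroup.subset_closure ⟨c, rfl⟩
  have h := sub_mem (gen (a * b)) (add_mem (gen a) (gen b))
  rwa [tmulU_mul_neg_mul, add_sub_cancel_left] at h

variable (R) in
/-- The homomorphism `u ↦ u ⊗ (-u)` from the units of `R` to `(R^× ⊗ R^×)_σ`. -/
noncomputable def negSymbol : Rˣ →* Multiplicative (Tsigma R) :=
  MonoidHom.mk' (fun u => Multiplicative.ofAdd (clsS R (tmulU R u (-u)))) fun a b => by
    rw [← ofAdd_add, tmulU_mul_neg_mul]
    simp only [map_add, clsS_tmulU_add_swap, add_zero]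

theorem negSymbol_apply (u : Rˣ) :
    negSymbol R u = Multiplicative.ofAdd (clsS R (tmulU R u (-u))) := rfl

theorem negSymbol_neg_one : negSymbol R (-1) = 1 := by
  rw [negSymbol_apply, neg_neg, tmulU_one_right, map_zero, ofAdd_zero]

theorem negSymbol_sq (r : Rˣ) : negSymbol R (r ^ 2) = 1 := by
  have h : tmulU R r (-r) + tmulU R r (-r) = tmulU R r r + tmulU R r r := by
    rw [← tmulU_mul_right, ← tmulU_mul_right, neg_mul_neg]
  rw [map_pow, pow_two, negSymbol_apply, ← ofAdd_add, ← map_add, h, map_add,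
    clsS_tmulU_add_swap, ofAdd_zero]

theorem exists_negSymbol_of_mem_sbarSub {t : TT R} (ht : t ∈ sbarSub R) :
    ∃ u : Rˣ, clsS R t = (negSymbol R u).toAdd := by
  induction ht using AddSubgroup.closure_induction with
  | mem x hx =>
    obtain ⟨a, rfl⟩ := hx
    exact ⟨a, rfl⟩
  | zero => exact ⟨1, by simp⟩
  | add x y _ _ hx hy =>
    obtain ⟨u, hu⟩ := hx
    obtain ⟨v, hv⟩ := hy
    exact ⟨u * v, by rw [map_add, hu, hv, map_mul, toAdd_mul]⟩
  | neg x _ hx =>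
    obtain ⟨u, hu⟩ := hx
    exact ⟨u⁻¹, by rw [map_neg, hu, map_inv, toAdd_inv]⟩

variable (R) in
/-- The projection `(R^× ⊗ R^×)_σ → (R^× ⊗ R^×)_σ̄`. -/
noncomputable def tsigmaProj : Tsigma R →+ Tsigmabar R :=
  QuotientAddGroup.lift (sigmaSub R) (clsSb R) fun x hx =>
    (QuotientAddGroup.eq_zero_iff x).2 (sigmaSub_le_sbarSub hx)

theorem tsigmaProj_clsS (t : TT R) : tsigmaProj R (clsS R t) = clsSb R t := rfl

theorem tsigmaProj_eq_zero_iff {z : Tsigma R} :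
    tsigmaProj R z = 0 ↔ ∃ u : Rˣ, z = (negSymbol R u).toAdd := by
  constructor
  · obtain ⟨t, rfl⟩ := QuotientAddGroup.mk_surjective z
    intro h
    exact exists_negSymbol_of_mem_sbarSub ((QuotientAddGroup.eq_zero_iff t).1 h)
  · rintro ⟨u, rfl⟩
    exact (QuotientAddGroup.eq_zero_iff _).2 (AddSubgroup.subset_closure ⟨u, rfl⟩)

theorem pBloch_hom_ext {A : Type*} [AddCommGroup A] {f g : pBloch R →+ A}
    (h : ∀ x : Wt R, f (pcl R x) = g (pcl R x)) : f = g := by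
  refine QuotientAddGroup.addMonoidHom_ext _ (Finsupp.addHom_ext' fun x => ?_)
  ext
  exact h x

/-- The inverse of `a` when `a` and `1 - a` are units. -/
noncomputable def Wt.inv (a : Wt R) : Wt R :=
  ⟨Ring.inverse (a : R), a.2.1.ringInverse, by
    have h : 1 - Ring.inverse (a : R) = -((1 - (a : R)) * Ring.inverse (a : R)) := by
      rw [sub_mul, one_mul, Ring.mul_inverse_cancel _ a.2.1, neg_sub]
    rw [h]
    exact (a.2.2.mul a.2.1.ringInverse).neg⟩

theorem map_pcl_add_pcl_inverse {lam : pBloch R →+ Tsigma R}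
    (hlam : ∀ x : Wt R, lam (pcl R x) = clsS R (tmulU R x.2.1.unit x.2.2.unit))
    {a ainv : Wt R} (h : (ainv : R) = Ring.inverse (a : R)) :
    lam (pcl R a + pcl R ainv) = (negSymbol R a.2.1.unit).toAdd := by
  have hinv : ainv.2.1.unit = a.2.1.unit⁻¹ := by
    rw [eq_inv_iff_mul_eq_one]
    ext
    simp [h, Ring.inverse_mul_cancel _ a.2.1]
  have hone : a.2.2.unit = -a.2.1.unit * ainv.2.2.unit := by
    ext
    simp [h, mul_sub, Ring.mul_inverse_cancel _ a.2.1]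
  rw [map_add, hlam, hlam, hinv, tmulU_inv_left, hone, tmulU_mul_right, ← map_add,
    add_neg_cancel_right]
  rfl

theorem ManyUnits.exists_unit_mul (hR : ManyUnits R) (u : Rˣ) :
    ∃ a b : Wt R, u = a.2.1.unit * b.2.1.unit := by
  let p : (Fin 2 → R) →ₗ[R] R := LinearMap.proj 0
  let q : (Fin 2 → R) →ₗ[R] R := LinearMap.proj 1
  obtain ⟨v, hv⟩ := hR 2 le_rfl 4 ![p, q, q - p, p - (u : R) • q] (by
    intro i
    fin_cases i
    · exact fun r => ⟨![r, 0], by simp [p]⟩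
    · exact fun r => ⟨![0, r], by simp [q]⟩
    · exact fun r => ⟨![0, r], by simp [p, q]⟩
    · exact fun r => ⟨![r, 0], by simp [p, q]⟩)
  obtain ⟨x, hx⟩ : IsUnit (v 0) := hv 0
  obtain ⟨y, hy⟩ : IsUnit (v 1) := hv 1
  have h2 : IsUnit ((y : R) - x) := by rw [hx, hy]; exact hv 2
  have h3 : IsUnit ((x : R) - u * y) := by rw [hx, hy]; exact hv 3
  refine ⟨⟨(x * y⁻¹ : Rˣ), Units.isUnit _, ?_⟩, ⟨(u * y * x⁻¹ : Rˣ), Units.isUnit _, ?_⟩, ?_⟩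
  · have h : 1 - ((x * y⁻¹ : Rˣ) : R) = ((y : R) - x) * (y⁻¹ : Rˣ) := by
      simp [sub_mul]
    rw [h]
    exact h2.mul (Units.isUnit _)
  · have h : 1 - ((u * y * x⁻¹ : Rˣ) : R) = ((x : R) - u * y) * (x⁻¹ : Rˣ) := by
      simp [sub_mul]
    rw [h]
    exact h3.mul (Units.isUnit _)
  · have h : u = x * y⁻¹ * (u * y * x⁻¹) := by
      rw [mul_comm]
      group
    rw [Units.ext_iff] at h ⊢
    exact h

end UnitTensors

/-- For a ring with many units there is a surjective homomorphism
`R^×/⟨-1, r² : r ∈ R^×⟩ → B'(R)/B(R)` sending (for `a, 1-a` units) the class of `a` to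
the class of `⟨a⟩ = [a] + [a⁻¹]`; `B'(R)/B(R)` is `2`-torsion and generated by the
classes of the `⟨a⟩`; and if every unit is a square then `B(R) = B'(R)`. -/
theorem stmt19 (R : Type) [CommRing R] (hR : ManyUnits R)
    (lam : pBloch R →+ Tsigma R)
    (hlam : ∀ x : Wt R, lam (pcl R x) = clsS R (tmulU R x.2.1.unit x.2.2.unit))
    (eta : pBloch R →+ Tsigmabar R)
    (heta : ∀ x : Wt R, eta (pcl R x) = clsSb R (tmulU R x.2.1.unit x.2.2.unit)) :
    (∃ f : (Rˣ ⧸ Subgroup.closure {u : Rˣ | u = -1 ∨ ∃ r : Rˣ, u = r ^ 2}) →*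
        Multiplicative (eta.ker ⧸ lam.ker.addSubgroupOf eta.ker),
      Function.Surjective f ∧
      ∀ (a ainv : Wt R) (y : eta.ker),
        (ainv : R) = Ring.inverse (a : R) →
        (y : pBloch R) = pcl R a + pcl R ainv →
        f (QuotientGroup.mk a.2.1.unit) = Multiplicative.ofAdd (QuotientAddGroup.mk y)) ∧
    (∀ q : eta.ker ⧸ lam.ker.addSubgroupOf eta.ker, q + q = 0) ∧
    (AddSubgroup.closure {q : eta.ker ⧸ lam.ker.addSubgroupOf eta.ker |
        ∃ (a ainv : Wt R) (y : eta.ker),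
          (ainv : R) = Ring.inverse (a : R) ∧
          (y : pBloch R) = pcl R a + pcl R ainv ∧
          q = QuotientAddGroup.mk y} = ⊤) ∧
    ((∀ u : Rˣ, ∃ r : Rˣ, r ^ 2 = u) → lam.ker = eta.ker) := by
  have heta_lam : eta = (tsigmaProj R).comp lam := pBloch_hom_ext fun x => by
    rw [heta, AddMonoidHom.comp_apply, hlam, tsigmaProj_clsS]
  have mem_ker : ∀ x, x ∈ eta.ker ↔ ∃ u : Rˣ, lam x = (negSymbol R u).toAdd := fun x => by
    rw [AddMonoidHom.mem_ker, heta_lam, AddMonoidHom.comp_apply, tsigmaProj_eq_zero_iff]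
  let i : (eta.ker ⧸ lam.ker.addSubgroupOf eta.ker) →+ Tsigma R :=
    QuotientAddGroup.lift _ (lam.comp eta.ker.subtype) fun x hx => hx
  have hi_mk : ∀ y : eta.ker, i (QuotientAddGroup.mk y) = lam y := fun _ => rfl
  have hi : Function.Injective i := by
    rw [injective_iff_map_eq_zero]
    intro q hq
    obtain ⟨y, rfl⟩ := QuotientAddGroup.mk_surjective q
    exact (QuotientAddGroup.eq_zero_iff y).2 hq
  have exists_symbol : ∀ q, ∃ u : Rˣ, i q = (negSymbol R u).toAdd := fun q => by
    obtain ⟨y, rfl⟩ := QuotientAddGroup.mk_surjective q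
    exact (mem_ker _).1 y.2
  have exists_gen : ∀ a : Wt R, ∃ y : eta.ker, (y : pBloch R) = pcl R a + pcl R a.inv ∧
      i (QuotientAddGroup.mk y) = (negSymbol R a.2.1.unit).toAdd := fun a =>
    have h := map_pcl_add_pcl_inverse hlam (a := a) (ainv := a.inv) rfl
    ⟨⟨_, (mem_ker _).2 ⟨_, h⟩⟩, rfl, h⟩
  have exists_preimage : ∀ u : Rˣ, ∃ q, i q = (negSymbol R u).toAdd := fun u => by
    obtain ⟨a, b, rfl⟩ := hR.exists_unit_mul u
    obtain ⟨y, -, hy⟩ := exists_gen a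
    obtain ⟨z, -, hz⟩ := exists_gen b
    exact ⟨QuotientAddGroup.mk y + QuotientAddGroup.mk z, by
      rw [map_add, hy, hz, map_mul, toAdd_mul]⟩
  choose g hg using exists_preimage
  let F : Rˣ →* Multiplicative (eta.ker ⧸ lam.ker.addSubgroupOf eta.ker) :=
    MonoidHom.mk' (fun u => Multiplicative.ofAdd (g u)) fun u v => by
      rw [← ofAdd_add]
      exact congrArg _ (hi (by rw [map_add, hg, hg, hg, map_mul, toAdd_mul]))
  have hF : ∀ u, F u = Multiplicative.ofAdd (g u) := fun _ => rfl
  have hF_ker : Subgroup.closure {u : Rˣ | u = -1 ∨ ∃ r : Rˣ, u = r ^ 2} ≤ F.ker := by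
    refine (Subgroup.closure_le _).2 fun u hu => ?_
    have h : negSymbol R u = 1 := by
      rcases hu with rfl | ⟨r, rfl⟩
      exacts [negSymbol_neg_one, negSymbol_sq r]
    have h0 : g u = 0 := hi (by rw [hg, h, toAdd_one, map_zero])
    rw [SetLike.mem_coe, MonoidHom.mem_ker, hF, h0, ofAdd_zero]
  refine ⟨⟨QuotientGroup.lift _ F hF_ker, ?_, ?_⟩, ?_, ?_, ?_⟩
  · intro q
    obtain ⟨u, hu⟩ := exists_symbol q.toAdd
    exact ⟨QuotientGroup.mk u, congrArg Multiplicative.ofAdd (hi ((hg u).trans hu.symm))⟩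
  · intro a ainv y ha hy
    have h : g a.2.1.unit = QuotientAddGroup.mk y := hi ?_
    · exact congrArg Multiplicative.ofAdd h
    rw [hg, hi_mk, hy, map_pcl_add_pcl_inverse hlam ha]
  · intro q
    obtain ⟨u, hu⟩ := exists_symbol q
    refine hi ?_
    rw [map_add, map_zero, hu, ← toAdd_mul, ← map_mul, ← pow_two, negSymbol_sq, toAdd_one]
  · refine eq_top_iff.2 fun q _ => ?_
    obtain ⟨u, hu⟩ := exists_symbol q
    obtain ⟨a, b, rfl⟩ := hR.exists_unit_mul u
    obtain ⟨y, hy, hy'⟩ := exists_gen a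
    obtain ⟨z, hz, hz'⟩ := exists_gen b
    have hq : q = QuotientAddGroup.mk y + QuotientAddGroup.mk z := hi (by
      rw [hu, map_mul, toAdd_mul, ← hy', ← hz', ← map_add])
    rw [hq]
    exact add_mem (AddSubgroup.subset_closure ⟨a, a.inv, y, rfl, hy, rfl⟩)
      (AddSubgroup.subset_closure ⟨b, b.inv, z, rfl, hz, rfl⟩)
  · intro hsq
    refine le_antisymm (fun x hx => ?_) fun x hx => ?_
    · exact (mem_ker x).2 ⟨1, by rw [AddMonoidHom.mem_ker.1 hx, map_one, toAdd_one]⟩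
    · obtain ⟨u, hu⟩ := (mem_ker x).1 hx
      obtain ⟨r, rfl⟩ := hsq u
      rw [AddMonoidHom.mem_ker, hu, negSymbol_sq, toAdd_one]
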